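/- Let w = w_T + w_N ∈ ℝ[B_n] with w_T a nonnegative combination of transpositions in S_n and w_N a nonnegative combination of diagonal elements s_A, A ⊆ {1,…,n}. If σ is a nontrivial irreducible representation of B_n whose restriction to S_n contains no copy of the trivial S_n-representation, then the minimal nontrivial eigenvalue of σ(Δ(w)) is at least the minimal nontrivial eigenvalue of Δ(w) on the pullback to B_n of the standard S_n-irrep [n−1,1]. -/

import Mathlib

abbrev Nn (n : ℕ) : Type := Multiplicative (Fin n → ZMod 2)

def permAddEquiv {n : ℕ} (π : Equiv.Perm (Fin n)) : (Fin n → ZMod 2) ≃+ (Fin n → ZMod 2) where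
  toFun f := f ∘ π.symm
  invFun f := f ∘ π
  left_inv f := by funext i; simp
  right_inv f := by funext i; simp
  map_add' f g := rfl

/-- `Sₙ` acting on `(C₂)ⁿ` by permuting coordinates. -/
def permAut (n : ℕ) : Equiv.Perm (Fin n) →* MulAut (Nn n) where
  toFun π := AddEquiv.toMultiplicative (permAddEquiv π)
  map_one' := by ext f; rfl
  map_mul' π ρ := by ext f; rfl

/-- The hyperoctahedral group `Bₙ = (C₂)ⁿ ⋊ Sₙ`. -/
abbrev Bn (n : ℕ) : Type := SemidirectProduct (Nn n) (Equiv.Perm (Fin n)) (permAut n)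

/-- the diagonal element `s_A`, with `-1` exactly at positions in `A`. -/
def sgn {n : ℕ} (A : Finset (Fin n)) : Nn n :=
  Multiplicative.ofAdd (fun i => if i ∈ A then (1 : ZMod 2) else 0)

section OwnMaterial
open Equiv


/-- evaluation of a formal integer combination of group elements -/
def evL {G R : Type*} [Monoid G] [Ring R] (φ : G →* R) (L : List (ℤ × G)) : R :=
  (L.map fun p => (p.1 : R) * φ p.2).sum

def mulL {G : Type*} [Monoid G] (L M : List (ℤ × G)) : List (ℤ × G) :=
  L.flatMap fun p => M.map fun q => (p.1 * q.1, p.2 * q.2)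

def smulL {G : Type*} (m : ℤ) (L : List (ℤ × G)) : List (ℤ × G) :=
  L.map fun p => (m * p.1, p.2)

def insL {G : Type*} (key : G → ℕ) (m : ℤ) (g : G) : List (ℤ × G) → List (ℤ × G)
  | [] => [(m, g)]
  | p :: L => if key g = key p.2 then (m + p.1, p.2) :: L else p :: insL key m g L

def nfL {G : Type*} (key : G → ℕ) : List (ℤ × G) → List (ℤ × G)
  | [] => []
  | p :: L => insL key p.1 p.2 (nfL key L)

section
variable {G R : Type*} [Monoid G] [Ring R] (φ : G →* R)

lemma evL_nil : evL φ [] = 0 := rfl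
lemma evL_cons (p : ℤ × G) (L) : evL φ (p :: L) = (p.1 : R) * φ p.2 + evL φ L := by
  simp [evL]
lemma evL_append (L M) : evL φ (L ++ M) = evL φ L + evL φ M := by
  simp [evL]
lemma evL_smul (m : ℤ) (L) : evL φ (smulL m L) = (m : R) * evL φ L := by
  induction L with
  | nil => simp [smulL, evL]
  | cons p L ih =>
    have : smulL m (p :: L) = (m * p.1, p.2) :: smulL m L := rfl
    rw [this, evL_cons, evL_cons, ih]; push_cast; noncomm_ring
lemma evL_mul (L M) : evL φ (mulL L M) = evL φ L * evL φ M := by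
  induction L with
  | nil => simp [mulL, evL]
  | cons p L ih =>
    have : mulL (p :: L) M = (M.map fun q => (p.1 * q.1, p.2 * q.2)) ++ mulL L M := by
      simp [mulL]
    rw [this, evL_append, ih, evL_cons, add_mul]
    congr 1
    clear this ih
    induction M with
    | nil => simp [evL]
    | cons q M ih =>
      rw [List.map_cons, evL_cons, evL_cons, ih]
      simp only [map_mul, mul_add, Int.cast_mul]
      congr 1
      rw [mul_assoc, mul_assoc]
      congr 1
      rw [← mul_assoc, ← mul_assoc, Int.cast_comm]
lemma evL_ins (key : G → ℕ) (hk : Function.Injective key) (m : ℤ) (g : G) (L) :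
    evL φ (insL key m g L) = (m : R) * φ g + evL φ L := by
  induction L with
  | nil => simp [insL, evL]
  | cons p L ih =>
    unfold insL
    split_ifs with h
    · rw [hk h]; rw [evL_cons, evL_cons]; push_cast; noncomm_ring
    · rw [evL_cons, evL_cons, ih]; abel
lemma evL_nf (key : G → ℕ) (hk : Function.Injective key) (L) : evL φ (nfL key L) = evL φ L := by
  induction L with
  | nil => rfl
  | cons p L ih => rw [nfL, evL_ins φ key hk, evL_cons, ih]
lemma evL_zero (L : List (ℤ × G)) (h : L.all (fun p => p.1 == 0) = true) : evL φ L = 0 := by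
  induction L with
  | nil => rfl
  | cons p L ih =>
    simp only [List.all_cons, Bool.and_eq_true, beq_iff_eq] at h
    rw [evL_cons, ih h.2, h.1]; simp

end

/-- formal version of `x o i j` -/
def xL {κ : Type*} [DecidableEq κ] (o i j : κ) : List (ℤ × Perm κ) :=
  [(1, swap i j), (-1, swap o i), (-1, swap o j), (if i = j then -1 else 0, 1)]

def dd {κ : Type*} [DecidableEq κ] (i j : κ) : ℤ := if i = j then 2 else 1

def mL {κ : Type*} [DecidableEq κ] (o i j k l : κ) : List (ℤ × Perm κ) :=
  (dd i j * dd k l, 1) :: smulL (-1) (mulL (xL o i j) (xL o k l))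

def sL {κ : Type*} [DecidableEq κ] (o i j k l : κ) : List (ℤ × Perm κ) :=
  mL o i j k l ++ mL o k l i j ++ mL o i k j l ++ mL o j l i k ++ mL o i l j k ++ mL o j k i l


section
variable {G R : Type*} [Monoid G] [Ring R] (φ : G →* R)

lemma evL_filter (L : List (ℤ × G)) : evL φ (L.filter (fun p => p.1 != 0)) = evL φ L := by
  induction L with
  | nil => rfl
  | cons p L ih =>
    by_cases h : p.1 = 0
    · rw [List.filter_cons_of_neg (by simp [h]), evL_cons, ih, h]; simp
    · rw [List.filter_cons_of_pos (by simp [h]), evL_cons, evL_cons, ih]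
end

def nz {G : Type*} (L : List (ℤ × G)) : List (ℤ × G) := L.filter (fun p => p.1 != 0)

def chk {G : Type*} [Monoid G] (key : G → ℕ) (L : List (ℤ × G)) : Bool :=
  (nfL key (mulL (nz (nfL key L)) (nz (nfL key L)) ++ smulL (-24) L)).all (fun p => p.1 == 0)

lemma chk_spec {G R : Type*} [Monoid G] [Ring R] (φ : G →* R) (key : G → ℕ)
    (hk : Function.Injective key) (L : List (ℤ × G)) (h : chk key L = true) :
    evL φ L * evL φ L = 24 * evL φ L := by
  have := evL_zero φ _ h
  rw [evL_nf φ key hk, evL_append, evL_mul, evL_smul] at this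
  unfold nz at this
  rw [evL_filter, evL_nf φ key hk] at this
  rw [← sub_eq_zero, ← this]; push_cast; noncomm_ring

def key {m : ℕ} (g : Perm (Fin m)) : ℕ := Nat.ofDigits 10 (List.ofFn fun i => (g i : ℕ))

lemma key_inj {m : ℕ} (hm : m ≤ 10) : Function.Injective (key (m := m)) := by
  intro g h e
  have := Nat.ofDigits_inj_of_len_eq (b := 10) (by norm_num) (by simp) ?_ ?_ e
  · rw [List.ofFn_inj] at this
    ext i
    exact congrFun this i
  · intro d hd
    rw [List.mem_ofFn] at hd
    obtain ⟨i, rfl⟩ := hd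
    omega
  · intro d hd
    rw [List.mem_ofFn] at hd
    obtain ⟨i, rfl⟩ := hd
    omega

def key5 (g : Perm (Fin 5)) : ℕ :=
  (g 0 : ℕ) + 5 * ((g 1 : ℕ) + 5 * ((g 2 : ℕ) + 5 * (g 3 : ℕ)))

set_option maxRecDepth 100000 in
theorem chk4 : chk key (sL (0 : Fin 4) 1 1 2 3) = true := by decide +kernel
set_option maxRecDepth 100000 in
theorem chk3 : chk key (sL (0 : Fin 3) 1 1 2 2) = true := by decide +kernel
set_option maxRecDepth 100000 in
theorem chk3' : chk key (sL (0 : Fin 3) 1 1 1 2) = true := by decide +kernel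
set_option maxRecDepth 100000 in
theorem chk2 : chk key (sL (0 : Fin 2) 1 1 1 1) = true := by decide +kernel
set_option maxRecDepth 100000 in
theorem chk5 : chk key (sL (0 : Fin 5) 1 2 3 4) = true := by decide +kernel

lemma swap_via {κ ι : Type*} [DecidableEq κ] [DecidableEq ι] (e : κ ↪ ι) (i j : κ) :
    Perm.viaEmbeddingHom e (swap i j) = swap (e i) (e j) := by
  ext x
  rw [Perm.viaEmbeddingHom_apply]
  by_cases hx : x ∈ Set.range e
  · obtain ⟨y, rfl⟩ := hx
    rw [Perm.viaEmbedding_apply]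
    rw [e.injective.map_swap]
  · rw [Perm.viaEmbedding_apply_of_notMem _ _ _ hx]
    rw [swap_apply_of_ne_of_ne]
    · rintro rfl; exact hx ⟨_, rfl⟩
    · rintro rfl; exact hx ⟨_, rfl⟩

section
variable {κ ι R : Type*} [DecidableEq κ] [DecidableEq ι] [Ring R] (φ : Perm ι →* R)

lemma ev_xL (o i j : ι) : evL φ (xL o i j) =
    φ (swap i j) - φ (swap o i) - φ (swap o j) - (if i = j then 1 else 0) := by
  simp only [xL, evL_cons, evL_nil]
  split_ifs <;> simp <;> abel

lemma ev_mL (o i j k l : ι) : evL φ (mL o i j k l) =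
    (dd i j : R) * (dd k l : R) - evL φ (xL o i j) * evL φ (xL o k l) := by
  simp only [mL, evL_cons, evL_smul, evL_mul]
  simp [sub_eq_add_neg]

lemma ev_sL (o i j k l : ι) : evL φ (sL o i j k l) =
    evL φ (mL o i j k l) + evL φ (mL o k l i j) + evL φ (mL o i k j l) + evL φ (mL o j l i k)
     + evL φ (mL o i l j k) + evL φ (mL o j k i l) := by
  simp only [sL, evL_append]

lemma dd_comm (i j : ι) : dd i j = dd j i := by simp [dd, eq_comm]

lemma ev_xL_comm (o i j : ι) : evL φ (xL o i j) = evL φ (xL o j i) := by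
  rw [ev_xL, ev_xL, swap_comm i j]; simp only [eq_comm (a := i) (b := j)]; abel

lemma ev_mL_comm1 (o i j k l : ι) : evL φ (mL o i j k l) = evL φ (mL o j i k l) := by
  rw [ev_mL, ev_mL, ev_xL_comm, dd_comm]
lemma ev_mL_comm2 (o i j k l : ι) : evL φ (mL o i j k l) = evL φ (mL o i j l k) := by
  rw [ev_mL, ev_mL, ev_xL_comm φ o k, dd_comm k]

lemma ev_sL_12 (o i j k l : ι) : evL φ (sL o i j k l) = evL φ (sL o j i k l) := by
  rw [ev_sL, ev_sL, ev_mL_comm1 φ o i j, ev_mL_comm2 φ o k l i j]; abel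
lemma ev_sL_23 (o i j k l : ι) : evL φ (sL o i j k l) = evL φ (sL o i k j l) := by
  rw [ev_sL, ev_sL, ev_mL_comm1 φ o j k i l, ev_mL_comm2 φ o i l j k]; abel
lemma ev_sL_34 (o i j k l : ι) : evL φ (sL o i j k l) = evL φ (sL o i j l k) := by
  rw [ev_sL, ev_sL, ev_mL_comm2 φ o i j k l, ev_mL_comm1 φ o k l i j]; abel

lemma ev_sL_via (e : κ ↪ ι) (o i j k l : κ) :
    evL (φ.comp (Perm.viaEmbeddingHom e)) (sL o i j k l) = evL φ (sL (e o) (e i) (e j) (e k) (e l)) := by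
  have hx : ∀ i j, evL (φ.comp (Perm.viaEmbeddingHom e)) (xL o i j) = evL φ (xL (e o) (e i) (e j)) := by
    intro i j
    simp only [ev_xL, MonoidHom.comp_apply, swap_via, e.injective.eq_iff]
  have hd : ∀ i j, dd (e i) (e j) = dd i j := by
    intro i j; simp [dd, e.injective.eq_iff]
  simp only [ev_sL, ev_mL, hx, hd]

/-- the key identity predicate -/
def KeyId (o i j k l : ι) : Prop :=
  evL φ (sL o i j k l) * evL φ (sL o i j k l) = 24 * evL φ (sL o i j k l)

lemma key_12 {o i j k l : ι} (h : KeyId φ o i j k l) : KeyId φ o j i k l := by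
  unfold KeyId at *; rwa [← ev_sL_12]
lemma key_23 {o i j k l : ι} (h : KeyId φ o i j k l) : KeyId φ o i k j l := by
  unfold KeyId at *; rwa [← ev_sL_23]
lemma key_34 {o i j k l : ι} (h : KeyId φ o i j k l) : KeyId φ o i j l k := by
  unfold KeyId at *; rwa [← ev_sL_34]

lemma key_via {m : ℕ} (hm : m ≤ 10) (f : Fin m → ι) (hf : Function.Injective f) (o i j k l : Fin m)
    (h : chk key (sL o i j k l) = true) : KeyId φ (f o) (f i) (f j) (f k) (f l) := by
  have := chk_spec (φ.comp (Perm.viaEmbeddingHom ⟨f, hf⟩)) key (key_inj hm) _ h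
  rw [ev_sL_via] at this
  exact this

lemma key_iiii {o i : ι} (hi : o ≠ i) : KeyId φ o i i i i := by
  refine key_via φ (m := 2) (by norm_num) ![o, i] ?_ 0 1 1 1 1 chk2
  intro a b; fin_cases a <;> fin_cases b <;> simp <;> grind
lemma key_iiij {o i j : ι} (hi : o ≠ i) (hj : o ≠ j) (hij : i ≠ j) : KeyId φ o i i i j := by
  refine key_via φ (m := 3) (by norm_num) ![o, i, j] ?_ 0 1 1 1 2 chk3'
  intro a b; fin_cases a <;> fin_cases b <;> simp <;> grind
lemma key_iijj {o i j : ι} (hi : o ≠ i) (hj : o ≠ j) (hij : i ≠ j) : KeyId φ o i i j j := by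
  refine key_via φ (m := 3) (by norm_num) ![o, i, j] ?_ 0 1 1 2 2 chk3
  intro a b; fin_cases a <;> fin_cases b <;> simp <;> grind
lemma key_iijk {o i j k : ι} (hi : o ≠ i) (hj : o ≠ j) (hk : o ≠ k) (hij : i ≠ j) (hik : i ≠ k)
    (hjk : j ≠ k) : KeyId φ o i i j k := by
  refine key_via φ (m := 4) (by norm_num) ![o, i, j, k] ?_ 0 1 1 2 3 chk4
  intro a b; fin_cases a <;> fin_cases b <;> simp <;> grind
lemma key_ijkl {o i j k l : ι} (hi : o ≠ i) (hj : o ≠ j) (hk : o ≠ k) (hl : o ≠ l) (hij : i ≠ j)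
    (hik : i ≠ k) (hil : i ≠ l) (hjk : j ≠ k) (hjl : j ≠ l) (hkl : k ≠ l) :
    KeyId φ o i j k l := by
  refine key_via φ (m := 5) (by norm_num) ![o, i, j, k, l] ?_ 0 1 2 3 4 chk5
  intro a b; fin_cases a <;> fin_cases b <;> simp <;> grind

lemma key_eq12 {o i k l : ι} (hi : o ≠ i) (hk : o ≠ k) (hl : o ≠ l) : KeyId φ o i i k l := by
  by_cases h1 : i = k
  · subst h1
    by_cases h2 : i = l
    · subst h2; exact key_iiii φ hi
    · exact key_iiij φ hi hl h2
  by_cases h2 : i = l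
  · subst h2; exact key_34 φ (key_iiij φ hi hk h1)
  by_cases h3 : k = l
  · subst h3; exact key_iijj φ hi hk h1
  exact key_iijk φ hi hk hl h1 h2 h3

lemma key_all {o i j k l : ι} (hi : o ≠ i) (hj : o ≠ j) (hk : o ≠ k) (hl : o ≠ l) :
    KeyId φ o i j k l := by
  by_cases h : i = j
  · subst h; exact key_eq12 φ hi hk hl
  by_cases h : i = k
  · subst h; exact key_23 φ (key_eq12 φ hi hj hl)
  by_cases h : i = l
  · subst h; exact key_34 φ (key_23 φ (key_eq12 φ hi hj hk))
  by_cases h : j = k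
  · subst h; exact key_12 φ (key_23 φ (key_eq12 φ hj hi hl))
  by_cases h : j = l
  · subst h; exact key_12 φ (key_34 φ (key_23 φ (key_eq12 φ hj hi hk)))
  by_cases h : k = l
  · subst h; exact key_23 φ (key_34 φ (key_12 φ (key_23 φ (key_eq12 φ hk hi hj))))
  apply key_ijkl <;> assumption
end

section
variable {ι : Type*}

def sum4 (r : Finset ι) (c : ι → ℝ) (F : ι → ι → ι → ι → ℝ) : ℝ :=
  ∑ i ∈ r, ∑ j ∈ r, ∑ k ∈ r, ∑ l ∈ r, c i * c j * c k * c l * F i j k l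

lemma sum4_add (r : Finset ι) (c : ι → ℝ) (F G : ι → ι → ι → ι → ℝ) :
    sum4 r c (fun i j k l => F i j k l + G i j k l) = sum4 r c F + sum4 r c G := by
  simp only [sum4, mul_add, Finset.sum_add_distrib]

lemma sum4_12 (r : Finset ι) (c : ι → ℝ) (F : ι → ι → ι → ι → ℝ) :
    sum4 r c (fun i j k l => F j i k l) = sum4 r c F := by
  unfold sum4
  rw [Finset.sum_comm]
  refine Finset.sum_congr rfl fun i _ => Finset.sum_congr rfl fun j _ =>
    Finset.sum_congr rfl fun k _ => Finset.sum_congr rfl fun l _ => by ring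
lemma sum4_23 (r : Finset ι) (c : ι → ℝ) (F : ι → ι → ι → ι → ℝ) :
    sum4 r c (fun i j k l => F i k j l) = sum4 r c F := by
  unfold sum4
  refine Finset.sum_congr rfl fun i _ => ?_
  rw [Finset.sum_comm]
  refine Finset.sum_congr rfl fun j _ =>
    Finset.sum_congr rfl fun k _ => Finset.sum_congr rfl fun l _ => by ring
lemma sum4_34 (r : Finset ι) (c : ι → ℝ) (F : ι → ι → ι → ι → ℝ) :
    sum4 r c (fun i j k l => F i j l k) = sum4 r c F := by
  unfold sum4
  refine Finset.sum_congr rfl fun i _ => Finset.sum_congr rfl fun j _ => ?_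
  rw [Finset.sum_comm]
  refine 
    Finset.sum_congr rfl fun k _ => Finset.sum_congr rfl fun l _ => by ring

lemma sum4_sym (r : Finset ι) (c : ι → ℝ) (F : ι → ι → ι → ι → ℝ) :
    sum4 r c (fun i j k l => F i j k l + F k l i j + F i k j l + F j l i k + F i l j k + F j k i l)
      = 6 * sum4 r c F := by
  have h1 : sum4 r c (fun i j k l => F i k j l) = sum4 r c F := sum4_23 r c F
  have h2 : sum4 r c (fun i j k l => F j k i l) = sum4 r c F :=
    (sum4_12 r c (fun i j k l => F i k j l)).trans h1
  have h3 : sum4 r c (fun i j k l => F j l i k) = sum4 r c F :=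
    (sum4_34 r c (fun i j k l => F j k i l)).trans h2
  have h4 : sum4 r c (fun i j k l => F k l i j) = sum4 r c F :=
    (sum4_23 r c (fun i j k l => F j l i k)).trans h3
  have h5 : sum4 r c (fun i j k l => F i l j k) = sum4 r c F :=
    (sum4_34 r c (fun i j k l => F i k j l)).trans h1
  rw [sum4_add, sum4_add, sum4_add, sum4_add, sum4_add, h1, h2, h3, h4, h5]
  change sum4 r c F + _ + _ + _ + _ + _ = _
  ring
end

section
variable {ι : Type*} [DecidableEq ι] {E : Type*} [NormedAddCommGroup E] [InnerProductSpace ℝ E]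
  (φ : Perm ι →* Module.End ℝ E)

lemma swap_symm_op
    (hφ : ∀ g v w, inner ℝ (φ g v) (φ g w) = inner ℝ v w)
    (i j : ι) (v w : E) :
    inner ℝ (φ (swap i j) v) w = inner ℝ v (φ (swap i j) w) := by
  rw [← hφ (swap i j), ← Module.End.mul_apply, ← map_mul, swap_mul_self, map_one]
  rfl

lemma xL_symm
    (hφ : ∀ g v w, inner ℝ (φ g v) (φ g w) = inner ℝ v w)
    (o i j : ι) (v w : E) :
    inner ℝ (evL φ (xL o i j) v) w = inner ℝ v (evL φ (xL o i j) w) := by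
  rw [ev_xL]
  have h : ∀ u : E, (φ (swap i j) - φ (swap o i) - φ (swap o j) - (if i = j then 1 else 0)) u
     = φ (swap i j) u - φ (swap o i) u - φ (swap o j) u - (if i = j then (1:ℝ) else 0) • u := by
    intro u; split_ifs <;> simp
  rw [h, h]
  simp only [inner_sub_left, inner_sub_right, inner_smul_left, inner_smul_right,
    swap_symm_op φ hφ]
  simp

lemma inner_mL
    (hφ : ∀ g v w, inner ℝ (φ g v) (φ g w) = inner ℝ v w)
    (o i j k l : ι) (v w : E) :
    inner ℝ (evL φ (mL o i j k l) v) w = (dd i j * dd k l : ℝ) * inner ℝ v w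
      - inner ℝ (evL φ (xL o k l) v) (evL φ (xL o i j) w) := by
  rw [ev_mL]
  have : ((dd i j : Module.End ℝ E) * (dd k l : Module.End ℝ E)) v
      = ((dd i j : ℝ) * (dd k l : ℝ)) • v := by
    rw [← Int.cast_mul, ← Int.cast_mul, Int.cast_smul_eq_zsmul]
    exact Module.End.intCast_apply _ _
  rw [LinearMap.sub_apply, this, Module.End.mul_apply, inner_sub_left, xL_symm φ hφ o i j,
    inner_smul_left]
  simp

lemma inner_mL_symm
    (hφ : ∀ g v w, inner ℝ (φ g v) (φ g w) = inner ℝ v w)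
    (o i j k l : ι) (v w : E) :
    inner ℝ (evL φ (mL o i j k l) v) w = inner ℝ v (evL φ (mL o k l i j) w) := by
  rw [inner_mL φ hφ, real_inner_comm (evL φ (mL o k l i j) w) v, inner_mL φ hφ,
    real_inner_comm w v, real_inner_comm (evL φ (xL o k l) v)]
  ring

lemma sL_nonneg
    (hφ : ∀ g v w, inner ℝ (φ g v) (φ g w) = inner ℝ v w)
    {o i j k l : ι} (hi : o ≠ i) (hj : o ≠ j) (hk : o ≠ k) (hl : o ≠ l) (v : E) :
    0 ≤ inner ℝ (evL φ (sL o i j k l) v) v := by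
  have hs : ∀ v w : E, inner ℝ (evL φ (sL o i j k l) v) w
      = inner ℝ v (evL φ (sL o i j k l) w) := by
    intro v w
    rw [ev_sL]
    simp only [LinearMap.add_apply, inner_add_left, inner_add_right]
    simp only [inner_mL_symm φ hφ o _ _ _ _ v w]
    ring
  have h := key_all φ hi hj hk hl
  unfold KeyId at h
  have h2 : inner ℝ (evL φ (sL o i j k l) v) (evL φ (sL o i j k l) v)
      = 24 * inner ℝ (evL φ (sL o i j k l) v) v := by
    rw [← hs, ← Module.End.mul_apply, h]
    have : (24 * evL φ (sL o i j k l)) v = (24:ℝ) • (evL φ (sL o i j k l) v) := by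
      rw [Module.End.mul_apply]
      have : (24 : Module.End ℝ E) = ((24 : ℕ) : Module.End ℝ E) := by norm_num
      rw [this, Module.End.natCast_apply, ← Nat.cast_smul_eq_nsmul ℝ]; norm_num
    rw [this, inner_smul_left]; simp
  have := real_inner_self_nonneg (x := evL φ (sL o i j k l) v)
  linarith

/-- octopus inequality -/
lemma octopus
    (hφ : ∀ g v w, inner ℝ (φ g v) (φ g w) = inner ℝ v w)
    (o : ι) (r : Finset ι) (ho : o ∉ r) (c : ι → ℝ) (hc : ∀ i, 0 ≤ c i) (v : E) :
    0 ≤ ∑ i ∈ r, ∑ j ∈ r, c i * c j * (inner ℝ (φ (swap i j) v) v - inner ℝ (φ (swap o i) v) v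
      - inner ℝ (φ (swap o j) v) v + inner ℝ v v) := by
  have hne : ∀ i ∈ r, o ≠ i := by rintro i hi rfl; exact ho hi
  set y : ι → ι → E := fun i j => evL φ (xL o i j) v with hy
  set G : E := ∑ i ∈ r, ∑ j ∈ r, (c i * c j) • y i j with hG
  set D : ℝ := ∑ i ∈ r, ∑ j ∈ r, c i * c j * (dd i j : ℝ) with hD
  have hdd : ∀ i j : ι, (0:ℝ) ≤ dd i j := by
    intro i j; unfold dd; split_ifs <;> norm_num
  have hD0 : 0 ≤ D := Finset.sum_nonneg fun i _ => Finset.sum_nonneg fun j _ =>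
    mul_nonneg (mul_nonneg (hc i) (hc j)) (hdd i j)
  have hsum : 0 ≤ sum4 r c (fun i j k l => inner ℝ (evL φ (mL o i j k l) v) v) := by
    have h6 := sum4_sym r c (fun i j k l => inner ℝ (evL φ (mL o i j k l) v) v)
    have : 0 ≤ sum4 r c (fun i j k l => inner ℝ (evL φ (sL o i j k l) v) v) := by
      refine Finset.sum_nonneg fun i hi => Finset.sum_nonneg fun j hj =>
        Finset.sum_nonneg fun k hk => Finset.sum_nonneg fun l hl => mul_nonneg ?_ ?_
      · have := hc i; have := hc j; have := hc k; have := hc l; positivity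
      · exact sL_nonneg φ hφ (hne i hi) (hne j hj) (hne k hk) (hne l hl) v
    simp only [ev_sL, LinearMap.add_apply, inner_add_left] at this
    rw [h6] at this
    linarith
  have hval : sum4 r c (fun i j k l => inner ℝ (evL φ (mL o i j k l) v) v)
      = D * D * inner ℝ v v - inner ℝ G G := by
    simp only [inner_mL φ hφ]
    rw [hD, hG]
    simp only [Finset.sum_mul, Finset.mul_sum, sum_inner, inner_sum, inner_smul_left,
      inner_smul_right, sum4]
    rw [← Finset.sum_sub_distrib]
    refine Finset.sum_congr rfl fun i _ => ?_
    rw [← Finset.sum_sub_distrib]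
    refine Finset.sum_congr rfl fun j _ => ?_
    rw [← Finset.sum_sub_distrib]
    refine Finset.sum_congr rfl fun k _ => ?_
    rw [← Finset.sum_sub_distrib]
    refine Finset.sum_congr rfl fun l _ => ?_
    simp only [hy, real_inner_comm (evL φ (xL o i j) v)]
    simp
    ring
  have hGv : -(D * inner ℝ v v) ≤ inner ℝ G v := by
    have h1 := abs_real_inner_le_norm G v
    have h2 : ‖G‖ ≤ D * ‖v‖ := by
      apply le_of_sq_le_sq _ (by positivity)
      rw [hval] at hsum
      rw [real_inner_self_eq_norm_sq, real_inner_self_eq_norm_sq] at hsum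
      nlinarith
    have h3 := neg_abs_le (inner ℝ G v)
    rw [real_inner_self_eq_norm_sq]
    have := norm_nonneg v
    nlinarith
  have hfin : ∑ i ∈ r, ∑ j ∈ r, c i * c j * (inner ℝ (φ (swap i j) v) v - inner ℝ (φ (swap o i) v) v
      - inner ℝ (φ (swap o j) v) v + inner ℝ v v) = inner ℝ G v + D * inner ℝ v v := by
    rw [hD, hG]
    simp only [Finset.sum_mul, sum_inner, inner_smul_left]
    rw [← Finset.sum_add_distrib]
    refine Finset.sum_congr rfl fun i _ => ?_
    rw [← Finset.sum_add_distrib]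
    refine Finset.sum_congr rfl fun j _ => ?_
    simp only [hy, ev_xL, dd]
    split_ifs <;> simp [inner_sub_left] <;> ring
  rw [hfin]; linarith
end

lemma form_ge_of_eig {E : Type*} [NormedAddCommGroup E] [InnerProductSpace ℝ E]
    [FiniteDimensional ℝ E] (K : Submodule ℝ E) (A : E →ₗ[ℝ] E)
    (hA : ∀ v w, inner ℝ (A v) w = inner ℝ v (A w)) (hK : ∀ v ∈ K, A v ∈ K) (ν : ℝ)
    (h : ∀ (l : ℝ) (v : E), v ∈ K → v ≠ 0 → A v = l • v → ν ≤ l) :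
    ∀ v ∈ K, ν * inner ℝ v v ≤ inner ℝ (A v) v := by
  intro v hv
  set B : K →ₗ[ℝ] K := A.restrict hK with hB
  have hBs : B.IsSymmetric := by
    intro a b
    simp only [Submodule.coe_inner, hB, LinearMap.coe_restrict_apply]
    exact hA _ _
  set b := hBs.eigenvectorBasis rfl with hb
  set ev := hBs.eigenvalues rfl with hev
  have hle : ∀ i, ν ≤ ev i := by
    intro i
    refine h (ev i) (b i : E) (b i).2 ?_ ?_
    · intro h0
      have := b.orthonormal.ne_zero i
      exact this (Subtype.ext h0)
    · have := hBs.apply_eigenvectorBasis rfl i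
      exact congrArg (Subtype.val) this
  set x : K := ⟨v, hv⟩ with hx
  have h1 : inner ℝ v v = ∑ i, inner ℝ x (b i) * inner ℝ (b i) x :=
    (b.sum_inner_mul_inner x x).symm
  have h2 : inner ℝ (A v) v = ∑ i, inner ℝ (B x) (b i) * inner ℝ (b i) x :=
    (b.sum_inner_mul_inner (B x) x).symm
  rw [h1, h2, Finset.mul_sum]
  refine Finset.sum_le_sum fun i _ => ?_
  rw [hBs x (b i)]
  rw [hBs.apply_eigenvectorBasis rfl i, inner_smul_right, real_inner_comm x (b i)]
  simp only [RCLike.ofReal_real_eq_id, id]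
  have := hle i
  nlinarith [mul_self_nonneg (inner ℝ x (b i))]

section
variable {ι : Type*} [DecidableEq ι]

def RWgap (s : Finset ι) (c : ι → ι → ℝ) (ν : ℝ) : Prop :=
  ∀ u : ι → ℝ, ∑ i ∈ s, u i = 0 →
    ν * ∑ i ∈ s, u i ^ 2 ≤ 1 / 2 * ∑ i ∈ s, ∑ j ∈ s, c i j * (u i - u j) ^ 2

lemma sum_swap_form (s : Finset ι) (u : ι → ℝ) {i j : ι} (hi : i ∈ s) (hj : j ∈ s) :
    ∑ y ∈ s, (u y - u (swap i j y)) * u y = (u i - u j) ^ 2 := by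
  by_cases hij : i = j
  · subst hij; simp
  rw [← Finset.sum_subset (s₁ := {i, j})]
  · rw [Finset.sum_pair hij]; simp; ring
  · intro y; simp; rintro (rfl | rfl) <;> assumption
  · intro y _ hy
    simp only [Finset.mem_insert, Finset.mem_singleton, not_or] at hy
    rw [swap_apply_of_ne_of_ne hy.1 hy.2]; simp

lemma sum_insert2 (x : ι) (r : Finset ι) (hx : x ∉ r) (f : ι → ι → ℝ)
    (hf : ∀ i j, f i j = f j i) (h0 : f x x = 0) :
    ∑ i ∈ insert x r, ∑ j ∈ insert x r, f i j
      = ∑ i ∈ r, ∑ j ∈ r, f i j + 2 * ∑ y ∈ r, f x y := by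
  simp only [Finset.sum_insert hx, Finset.sum_add_distrib, h0]
  have : ∑ i ∈ r, f i x = ∑ i ∈ r, f x i := Finset.sum_congr rfl fun i _ => hf i x
  rw [this]; ring

noncomputable def cred (c : ι → ι → ℝ) (x : ι) (r : Finset ι) (i j : ι) : ℝ :=
  c i j + c x i * c x j / ∑ y ∈ r, c x y

lemma star_id {ι : Type*} (r : Finset ι) (c u : ι → ℝ) (hc : ∀ i, 0 ≤ c i) :
    ∑ y ∈ r, c y * ((∑ i ∈ r, c i * u i) / (∑ i ∈ r, c i) - u y) ^ 2
      = 1 / 2 * ∑ i ∈ r, ∑ j ∈ r, c i * c j / (∑ i ∈ r, c i) * (u i - u j) ^ 2 := by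
  set C := ∑ i ∈ r, c i with hC
  by_cases h0 : C = 0
  · have : ∀ y ∈ r, c y = 0 := (Finset.sum_eq_zero_iff_of_nonneg fun i _ => hc i).1 (hC ▸ h0)
    rw [h0]
    simp only [div_zero, zero_mul, Finset.sum_const_zero, mul_zero]
    refine Finset.sum_eq_zero fun y hy => ?_
    rw [this y hy]; ring
  set M := ∑ i ∈ r, c i * u i with hM
  set Q := ∑ i ∈ r, c i * u i ^ 2 with hQ
  have h1 : ∑ y ∈ r, c y * (M / C - u y) ^ 2 = (M / C) ^ 2 * C - 2 * (M / C) * M + Q := by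
    rw [hC, hQ]; nth_rw 4 [hM]
    rw [Finset.mul_sum, Finset.mul_sum, ← Finset.sum_sub_distrib, ← Finset.sum_add_distrib]
    refine Finset.sum_congr rfl fun y _ => by ring
  have h2 : ∑ i ∈ r, ∑ j ∈ r, c i * c j / C * (u i - u j) ^ 2 = (Q * C - 2 * (M * M) + C * Q) / C := by
    rw [eq_div_iff h0]
    have e1 : Q * C = ∑ i ∈ r, ∑ j ∈ r, (c i * u i ^ 2) * c j := by
      rw [hQ, hC, Finset.sum_mul_sum]
    have e2 : M * M = ∑ i ∈ r, ∑ j ∈ r, (c i * u i) * (c j * u j) := by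
      rw [hM, Finset.sum_mul_sum]
    have e3 : C * Q = ∑ i ∈ r, ∑ j ∈ r, c i * (c j * u j ^ 2) := by
      rw [hQ, hC, Finset.sum_mul_sum]
    rw [e1, e2, e3]
    simp only [Finset.mul_sum, Finset.sum_mul]
    rw [← Finset.sum_sub_distrib, ← Finset.sum_add_distrib]
    refine Finset.sum_congr rfl fun i _ => ?_
    rw [← Finset.sum_sub_distrib, ← Finset.sum_add_distrib]
    refine Finset.sum_congr rfl fun j _ => ?_
    field_simp
    ring
  rw [h1, h2]
  field_simp
  ring

lemma rw_reduce (x : ι) (r : Finset ι) (hx : x ∉ r) (c : ι → ι → ℝ) (hc : ∀ i j, 0 ≤ c i j)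
    (hsym : ∀ i j, c i j = c j i) (ν : ℝ) (hν : 0 ≤ ν) (h : RWgap (insert x r) c ν) :
    RWgap r (cred c x r) ν := by
  intro u hu
  set C := ∑ y ∈ r, c x y with hC
  set m := (∑ y ∈ r, c x y * u y) / C with hm
  set a := m / ((insert x r).card : ℝ) with ha
  set w : ι → ℝ := fun i => (if i = x then m else u i) - a with hw
  have hwr : ∀ i ∈ r, w i = u i - a := by
    intro i hi
    have : i ≠ x := by rintro rfl; exact hx hi
    simp [hw, this]
  have hwx : w x = m - a := by simp [hw]
  have hw0 : ∑ i ∈ insert x r, w i = 0 := by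
    rw [hw, Finset.sum_sub_distrib, Finset.sum_insert hx]
    rw [Finset.sum_congr rfl (g := u) (fun i hi => by
      have : i ≠ x := by rintro rfl; exact hx hi
      simp [this])]
    rw [hu, Finset.sum_const, nsmul_eq_mul, ha]
    have : ((insert x r).card : ℝ) ≠ 0 := by
      have : (insert x r).card ≠ 0 := by simp
      exact_mod_cast this
    simp only [if_true]
    field_simp
    ring
  have key := h w hw0
  rw [sum_insert2 x r hx (fun i j => c i j * (w i - w j) ^ 2)
    (fun i j => by rw [hsym i j]; ring) (by simp)] at key
  have k1 : ∑ i ∈ r, ∑ j ∈ r, c i j * (w i - w j) ^ 2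
      = ∑ i ∈ r, ∑ j ∈ r, c i j * (u i - u j) ^ 2 := by
    refine Finset.sum_congr rfl fun i hi => Finset.sum_congr rfl fun j hj => ?_
    rw [hwr i hi, hwr j hj]; ring
  have k2 : ∑ y ∈ r, c x y * (w x - w y) ^ 2 = ∑ y ∈ r, c x y * (m - u y) ^ 2 := by
    refine Finset.sum_congr rfl fun i hi => ?_
    rw [hwr i hi, hwx]; ring
  have k3 := star_id r (c x) u (hc x)
  rw [k1, k2, k3] at key
  have k4 : ∑ i ∈ r, u i ^ 2 ≤ ∑ i ∈ insert x r, w i ^ 2 := by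
    rw [Finset.sum_insert hx]
    rw [Finset.sum_congr rfl (fun i hi => by rw [hwr i hi] : ∀ i ∈ r, w i ^ 2 = (u i - a) ^ 2)]
    have : ∑ i ∈ r, (u i - a) ^ 2 = ∑ i ∈ r, u i ^ 2 - 2 * a * ∑ i ∈ r, u i + ∑ i ∈ r, a ^ 2 := by
      rw [Finset.mul_sum, ← Finset.sum_sub_distrib, ← Finset.sum_add_distrib]
      exact Finset.sum_congr rfl fun i _ => by ring
    rw [this, hu]
    have : 0 ≤ ∑ i ∈ r, a ^ 2 := Finset.sum_nonneg fun i _ => sq_nonneg a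
    nlinarith [sq_nonneg (w x)]
  have k5 : ∑ i ∈ r, ∑ j ∈ r, cred c x r i j * (u i - u j) ^ 2
      = ∑ i ∈ r, ∑ j ∈ r, c i j * (u i - u j) ^ 2
        + ∑ i ∈ r, ∑ j ∈ r, c x i * c x j / (∑ y ∈ r, c x y) * (u i - u j) ^ 2 := by
    simp only [cred, add_mul, Finset.sum_add_distrib]
  rw [k5]
  have := mul_le_mul_of_nonneg_left k4 hν
  linarith
end

section
variable {ι : Type*} [DecidableEq ι] {E : Type*} [NormedAddCommGroup E] [InnerProductSpace ℝ E]
  (φ : Perm ι →* Module.End ℝ E)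

def InvS (s : Finset ι) : Submodule ℝ E where
  carrier := {w | ∀ i ∈ s, ∀ j ∈ s, φ (swap i j) w = w}
  add_mem' := by intro a b ha hb i hi j hj; rw [map_add, ha i hi j hj, hb i hi j hj]
  zero_mem' := by intro i _ j _; simp
  smul_mem' := by intro t a ha i hi j hj; rw [map_smul, ha i hi j hj]

/-- the double energy -/
noncomputable def En (s : Finset ι) (c : ι → ι → ℝ) (v : E) : ℝ :=
  1 / 2 * ∑ i ∈ s, ∑ j ∈ s, c i j * (inner ℝ v v - inner ℝ (φ (swap i j) v) v)

lemma En_reduce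
    (hφ : ∀ g v w, inner ℝ (φ g v) (φ g w) = inner ℝ v w)
    (x : ι) (r : Finset ι) (hx : x ∉ r) (c : ι → ι → ℝ) (hc : ∀ i j, 0 ≤ c i j)
    (hsym : ∀ i j, c i j = c j i) (v : E) : En φ r (cred c x r) v ≤ En φ (insert x r) c v := by
  unfold En
  rw [sum_insert2 x r hx (fun i j => c i j * (inner ℝ v v - inner ℝ (φ (swap i j) v) v))
    (fun i j => by rw [hsym i j, swap_comm]) (by
      rw [swap_self]; change _ * (_ - inner ℝ (φ 1 v) v) = 0; simp)]
  have k5 : ∑ i ∈ r, ∑ j ∈ r, cred c x r i j * (inner ℝ v v - inner ℝ (φ (swap i j) v) v)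
      = ∑ i ∈ r, ∑ j ∈ r, c i j * (inner ℝ v v - inner ℝ (φ (swap i j) v) v)
        + ∑ i ∈ r, ∑ j ∈ r, c x i * c x j / (∑ y ∈ r, c x y)
          * (inner ℝ v v - inner ℝ (φ (swap i j) v) v) := by
    simp only [cred, add_mul, Finset.sum_add_distrib]
  rw [k5]
  set C := ∑ y ∈ r, c x y with hC
  have hC0 : 0 ≤ C := Finset.sum_nonneg fun i _ => hc x i
  have hoct := octopus φ hφ x r hx (c x) (hc x) v
  suffices hs : ∑ i ∈ r, ∑ j ∈ r, c x i * c x j / C * (inner ℝ v v - inner ℝ (φ (swap i j) v) v)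
      ≤ 2 * ∑ y ∈ r, c x y * (inner ℝ v v - inner ℝ (φ (swap x y) v) v) by linarith
  rcases hC0.eq_or_lt with h0 | h0
  · have hz : ∀ y ∈ r, c x y = 0 :=
      (Finset.sum_eq_zero_iff_of_nonneg fun i _ => hc x i).1 (hC ▸ h0.symm)
    rw [← h0]
    simp only [div_zero, zero_mul, Finset.sum_const_zero]
    rw [Finset.sum_eq_zero (fun y hy => by rw [hz y hy, zero_mul])]
    simp
  · have e1 : ∑ i ∈ r, ∑ j ∈ r, c x i * c x j / C * (inner ℝ v v - inner ℝ (φ (swap i j) v) v)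
        = (∑ i ∈ r, ∑ j ∈ r, c x i * c x j * (inner ℝ v v - inner ℝ (φ (swap i j) v) v)) / C := by
      rw [Finset.sum_div]
      refine Finset.sum_congr rfl fun i _ => ?_
      rw [Finset.sum_div]
      refine Finset.sum_congr rfl fun i _ => by ring
    rw [e1, div_le_iff₀ h0]
    set f : ι → ℝ := fun y => inner ℝ v v - inner ℝ (φ (swap x y) v) v with hf
    have e2 : (∑ y ∈ r, c x y * f y) * C = ∑ i ∈ r, ∑ j ∈ r, c x i * f i * c x j := by
      rw [hC, Finset.sum_mul_sum]
    have e3 : C * (∑ y ∈ r, c x y * f y) = ∑ i ∈ r, ∑ j ∈ r, c x i * (c x j * f j) := by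
      rw [hC, Finset.sum_mul_sum]
    have e4 : 2 * (∑ y ∈ r, c x y * f y) * C
       = ∑ i ∈ r, ∑ j ∈ r, c x i * f i * c x j + ∑ i ∈ r, ∑ j ∈ r, c x i * (c x j * f j) := by
      rw [← e2, ← e3]; ring
    rw [e4, ← sub_nonneg]
    refine hoct.trans_eq ?_
    rw [← Finset.sum_add_distrib, ← Finset.sum_sub_distrib]
    refine Finset.sum_congr rfl fun i _ => ?_
    rw [← Finset.sum_add_distrib, ← Finset.sum_sub_distrib]
    refine Finset.sum_congr rfl fun j _ => ?_
    simp only [hf]; ring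

lemma swap_W (x : ι) (r : Finset ι) (hx : x ∉ r) (w : E) (hw : w ∈ InvS φ r) {i j y : ι}
    (hi : i ∈ insert x r) (hj : j ∈ insert x r) (hy : y ∈ insert x r) :
    φ (swap i j) (φ (swap x y) w) = φ (swap x (swap i j y)) w := by
  have main : ∀ {j y : ι}, j ∈ insert x r → y ∈ insert x r →
      φ (swap x j) (φ (swap x y) w) = φ (swap x (swap x j y)) w := by
    intro j y hj hy
    by_cases hjx : j = x
    · subst hjx; rw [swap_self]; change φ 1 _ = φ (swap j y) w; simp
    by_cases hyx : y = x
    · subst hyx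
      rw [swap_apply_left, swap_self]
      change φ (swap y j) (φ 1 w) = _; simp
    have hjr : j ∈ r := (Finset.mem_insert.1 hj).resolve_left hjx
    have hyr : y ∈ r := (Finset.mem_insert.1 hy).resolve_left hyx
    by_cases hjy : j = y
    · subst hjy
      rw [swap_apply_right, swap_self, ← Module.End.mul_apply, ← map_mul, swap_mul_self]; rfl
    · rw [swap_apply_of_ne_of_ne hyx (Ne.symm hjy)]
      have hwjy := hw j hjr y hyr
      conv_rhs => rw [← hwjy]
      rw [← Module.End.mul_apply, ← Module.End.mul_apply, ← map_mul, ← map_mul]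
      congr 2
      ext z
      simp only [Perm.mul_apply, swap_apply_def]
      split_ifs <;> simp_all
  by_cases hix : i = x
  · subst hix; exact main hj hy
  by_cases hjx : j = x
  · subst hjx; rw [swap_comm i j]; exact main hi hy
  have hir : i ∈ r := (Finset.mem_insert.1 hi).resolve_left hix
  have hjr : j ∈ r := (Finset.mem_insert.1 hj).resolve_left hjx
  have hwij := hw i hir j hjr
  conv_rhs => rw [← hwij]
  rw [← Module.End.mul_apply, ← Module.End.mul_apply, ← map_mul, ← map_mul]
  congr 2
  ext z
  have hx' : swap i j x = x := swap_apply_of_ne_of_ne (Ne.symm hix) (Ne.symm hjx)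
  conv_rhs => rw [← hx']
  rw [swap_apply_apply, mul_assoc, mul_assoc, swap_inv, swap_mul_self, mul_one]

theorem aclr
    (hφ : ∀ g v w, inner ℝ (φ g v) (φ g w) = inner ℝ v w)
    [FiniteDimensional ℝ E] (s : Finset ι) : ∀ (c : ι → ι → ℝ) (_ : ∀ i j, 0 ≤ c i j)
    (_ : ∀ i j, c i j = c j i) (ν : ℝ) (_ : 0 ≤ ν) (_ : RWgap s c ν) (v : E)
    (_ : ∀ w ∈ InvS φ s, inner ℝ v w = 0), ν * inner ℝ v v ≤ En φ s c v := by
  induction s using Finset.induction_on with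
  | empty =>
    intro c hc hsym ν hν hg v hv
    have : v ∈ InvS φ (∅ : Finset ι) := by intro i hi; simp at hi
    rw [hv v this]; simp [En]
  | insert x r hx ih =>
    intro c hc hsym ν hν hg v hv
    set s := insert x r with hs
    set A : E →ₗ[ℝ] E := (1 / 2 : ℝ) • ∑ i ∈ s, ∑ j ∈ s, c i j • (LinearMap.id - φ (swap i j))
      with hA
    have hAv : ∀ v w, inner ℝ (A v) w
        = 1 / 2 * ∑ i ∈ s, ∑ j ∈ s, c i j * (inner ℝ v w - inner ℝ (φ (swap i j) v) w) := by
      intro v w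
      simp [hA, LinearMap.sum_apply, sum_inner, inner_smul_left, inner_sub_left]
    have hAs : ∀ v w, inner ℝ (A v) w = inner ℝ v (A w) := by
      intro v w
      rw [real_inner_comm (A w) v, hAv, hAv]
      congr 1
      refine Finset.sum_congr rfl fun i _ => Finset.sum_congr rfl fun j _ => ?_
      rw [swap_symm_op φ hφ, real_inner_comm w v, real_inner_comm v (φ (swap i j) w)]
    have hEn : ∀ v, En φ s c v = inner ℝ (A v) v := by intro v; rw [hAv]; rfl
    have hAK : ∀ v ∈ (InvS φ s)ᗮ, A v ∈ (InvS φ s)ᗮ := by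
      intro v hv
      rw [Submodule.mem_orthogonal'] at hv ⊢
      intro w hw
      rw [hAs]
      have : A w = 0 := by
        simp only [hA, LinearMap.smul_apply, LinearMap.sum_apply, LinearMap.sub_apply,
          LinearMap.id_apply]
        rw [Finset.sum_eq_zero, smul_zero]
        intro i hi
        refine Finset.sum_eq_zero fun j hj => ?_
        rw [hw i hi j hj]; simp
      rw [this, inner_zero_right]
    rw [hEn]
    refine form_ge_of_eig (InvS φ s)ᗮ A hAs hAK ν ?_ v ((Submodule.mem_orthogonal' _ _).2 hv)
    clear hv v
    intro l v hv hv0 hl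
    rw [Submodule.mem_orthogonal'] at hv
    have hvpos : 0 < inner ℝ v v := real_inner_self_pos.2 hv0
    by_cases hcase : ∀ w ∈ InvS φ r, inner ℝ v w = 0
    · have h1 := ih (cred c x r) ?_ ?_ ν hν (rw_reduce x r hx c hc hsym ν hν hg) v hcase
      · have h2 := En_reduce φ hφ x r hx c hc hsym v
        rw [← hs, hEn, hl, inner_smul_left] at h2
        simp only [conj_trivial] at h2
        exact le_of_mul_le_mul_right (h1.trans h2) hvpos
      · intro i j
        exact add_nonneg (hc i j) (div_nonneg (mul_nonneg (hc x i) (hc x j))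
          (Finset.sum_nonneg fun y _ => hc x y))
      · intro i j; unfold cred; rw [hsym i j, mul_comm (c x i)]
    · push Not at hcase
      obtain ⟨w, hw, hvw⟩ := hcase
      set u : ι → ℝ := fun y => inner ℝ v (φ (swap x y) w) with hu
      have hxs : x ∈ s := Finset.mem_insert_self x r
      have hux : u x ≠ 0 := by
        simp only [hu, swap_self]
        change inner ℝ v (φ 1 w) ≠ 0
        simpa using hvw
      have hmaps : ∀ i ∈ s, ∀ j ∈ s, ∀ y ∈ s, swap i j y ∈ s := by
        intro i hi j hj y hy
        rw [swap_apply_def]; split_ifs <;> assumption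
      have hu0 : ∑ y ∈ s, u y = 0 := by
        simp only [hu]
        rw [← inner_sum]
        apply hv
        intro i hi j hj
        rw [map_sum]
        rw [Finset.sum_congr rfl (fun y hy => swap_W φ x r hx w hw hi hj hy)]
        refine Finset.sum_bij' (fun y _ => swap i j y) (fun y _ => swap i j y)
          (fun y hy => hmaps i hi j hj y hy) (fun y hy => hmaps i hi j hj y hy) ?_ ?_ ?_
        · intro y _; simp
        · intro y _; simp
        · intro y _; rfl
      have hlu : ∀ y ∈ s, l * u y = 1 / 2 * ∑ i ∈ s, ∑ j ∈ s, c i j * (u y - u (swap i j y)) := by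
        intro y hy
        have e : inner ℝ (A v) (φ (swap x y) w) = l * u y := by
          rw [hl, inner_smul_left]; simp [hu]
        rw [← e, hAv]
        congr 1
        refine Finset.sum_congr rfl fun i hi => Finset.sum_congr rfl fun j hj => ?_
        rw [swap_symm_op φ hφ, swap_W φ x r hx w hw hi hj hy]
      have hform : l * ∑ y ∈ s, u y ^ 2 = 1 / 2 * ∑ i ∈ s, ∑ j ∈ s, c i j * (u i - u j) ^ 2 := by
        calc l * ∑ y ∈ s, u y ^ 2 = ∑ y ∈ s, (l * u y) * u y := by
              rw [Finset.mul_sum]; exact Finset.sum_congr rfl fun y _ => by ring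
          _ = ∑ y ∈ s, (1 / 2 * ∑ i ∈ s, ∑ j ∈ s, c i j * (u y - u (swap i j y))) * u y :=
              Finset.sum_congr rfl fun y hy => by rw [hlu y hy]
          _ = 1 / 2 * ∑ y ∈ s, ∑ i ∈ s, ∑ j ∈ s, c i j * ((u y - u (swap i j y)) * u y) := by
              rw [Finset.mul_sum]
              refine Finset.sum_congr rfl fun y _ => ?_
              rw [mul_assoc, Finset.sum_mul]
              congr 1
              refine Finset.sum_congr rfl fun i _ => ?_
              rw [Finset.sum_mul]
              exact Finset.sum_congr rfl fun j _ => by ring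
          _ = 1 / 2 * ∑ i ∈ s, ∑ j ∈ s, c i j * (u i - u j) ^ 2 := by
              congr 1
              rw [Finset.sum_comm]
              refine Finset.sum_congr rfl fun i hi => ?_
              rw [Finset.sum_comm]
              refine Finset.sum_congr rfl fun j hj => ?_
              rw [← Finset.mul_sum, sum_swap_form s u hi hj]
      have hpos : 0 < ∑ y ∈ s, u y ^ 2 :=
        Finset.sum_pos' (fun y _ => sq_nonneg _) ⟨x, hxs, by positivity⟩
      have := hg u hu0
      rw [← hform] at this
      exact le_of_mul_le_mul_right this hpos
end





section
variable {n : ℕ}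

def wt (a : Fin n × Fin n → ℝ) (i j : Fin n) : ℝ :=
  if i < j then a (i, j) else if j < i then a (j, i) else 0

lemma wt_nonneg (a : Fin n × Fin n → ℝ) (ha : ∀ p, 0 ≤ a p) (i j) : 0 ≤ wt a i j := by
  unfold wt; split_ifs <;> simp [ha]

lemma wt_symm (a : Fin n × Fin n → ℝ) (i j) : wt a i j = wt a j i := by
  unfold wt
  rcases lt_trichotomy i j with h | h | h
  · simp [h, h.not_gt]
  · simp [h]
  · simp [h, h.not_gt]

lemma sum_pairs (a : Fin n × Fin n → ℝ) (F : Fin n → Fin n → ℝ) (hF : ∀ i j, F i j = F j i) :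
    ∑ p ∈ Finset.univ.filter (fun p : Fin n × Fin n => p.1 < p.2), a p * F p.1 p.2
      = 1 / 2 * ∑ i, ∑ j, wt a i j * F i j := by
  have h1 : ∑ p ∈ Finset.univ.filter (fun p : Fin n × Fin n => p.1 < p.2), a p * F p.1 p.2
      = ∑ i, ∑ j, (if i < j then a (i, j) * F i j else 0) := by
    rw [Finset.sum_filter, Fintype.sum_prod_type]
  have h2 : ∑ i, ∑ j, wt a i j * F i j = ∑ i, ∑ j, (if i < j then a (i, j) * F i j else 0)
      + ∑ i, ∑ j, (if j < i then a (j, i) * F j i else 0) := by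
    rw [← Finset.sum_add_distrib]
    refine Finset.sum_congr rfl fun i _ => ?_
    rw [← Finset.sum_add_distrib]
    refine Finset.sum_congr rfl fun j _ => ?_
    unfold wt
    rcases lt_trichotomy i j with h | h | h
    · simp [h, h.not_gt]
    · simp [h]
    · simp [h, h.not_gt, hF i j]
  have h3 : ∑ i : Fin n, ∑ j : Fin n, (if j < i then a (j, i) * F j i else 0)
    = ∑ i, ∑ j, (if i < j then a (i, j) * F i j else 0) := Finset.sum_comm
  rw [h1, h2, h3]; ring

/-- quadratic form of the standard Laplacian -/
lemma std_form (a : Fin n × Fin n → ℝ) (u : Fin n → ℝ) :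
    ∑ x, (∑ p ∈ Finset.univ.filter (fun p : Fin n × Fin n => p.1 < p.2),
        a p * (u x - u (Equiv.swap p.1 p.2 x))) * u x
      = 1 / 2 * ∑ i, ∑ j, wt a i j * (u i - u j) ^ 2 := by
  rw [← sum_pairs a (fun i j => (u i - u j) ^ 2) (fun i j => by ring)]
  simp only [Finset.sum_mul]
  rw [Finset.sum_comm]
  refine Finset.sum_congr rfl fun p _ => ?_
  rw [← sum_swap_form Finset.univ u (Finset.mem_univ p.1) (Finset.mem_univ p.2), Finset.mul_sum]
  exact Finset.sum_congr rfl fun x _ => by ring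

lemma rwgap_of_min (a : Fin n × Fin n → ℝ) (ν : ℝ)
    (h : ∀ (ν' : ℝ) (u : Fin n → ℝ), u ≠ 0 → (∑ i, u i = 0) →
      (fun x => ∑ p ∈ Finset.univ.filter (fun p : Fin n × Fin n => p.1 < p.2),
        a p * (u x - u (Equiv.swap p.1 p.2 x))) = ν' • u → ν ≤ ν') :
    RWgap Finset.univ (wt a) ν := by
  set P := Finset.univ.filter (fun p : Fin n × Fin n => p.1 < p.2)
  let A : EuclideanSpace ℝ (Fin n) →ₗ[ℝ] EuclideanSpace ℝ (Fin n) :=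
    { toFun := fun u => WithLp.toLp 2 fun x => ∑ p ∈ P, a p * (u x - u (Equiv.swap p.1 p.2 x))
      map_add' := by
        intro u v; ext x
        simp only [PiLp.add_apply]
        rw [← Finset.sum_add_distrib]
        exact Finset.sum_congr rfl fun p _ => by ring
      map_smul' := by
        intro t u; ext x
        simp only [PiLp.smul_apply, smul_eq_mul, RingHom.id_apply]
        rw [Finset.mul_sum]
        exact Finset.sum_congr rfl fun p _ => by ring }
  have hAx : ∀ u x, A u x = ∑ p ∈ P, a p * (u x - u (Equiv.swap p.1 p.2 x)) := fun u x => rfl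
  let K : Submodule ℝ (EuclideanSpace ℝ (Fin n)) :=
    { carrier := {u | ∑ i, u i = 0}
      add_mem' := by
        intro u v hu hv
        simp only [Set.mem_ofPred_eq, PiLp.add_apply, Finset.sum_add_distrib] at *
        rw [hu, hv, add_zero]
      zero_mem' := by simp
      smul_mem' := by
        intro t u hu
        simp only [Set.mem_ofPred_eq, PiLp.smul_apply, smul_eq_mul, ← Finset.mul_sum] at *
        rw [hu, mul_zero] }
  have hin : ∀ u v : EuclideanSpace ℝ (Fin n), inner ℝ u v = ∑ x, u x * v x := by
    intro u v
    rw [PiLp.inner_apply]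
    exact Finset.sum_congr rfl fun x _ => by simp [mul_comm]
  have hsym : ∀ u v, inner ℝ (A u) v = inner ℝ u (A v) := by
    intro u v
    rw [hin, hin]
    simp only [hAx, Finset.sum_mul, Finset.mul_sum]
    rw [Finset.sum_comm]
    conv_rhs => rw [Finset.sum_comm]
    refine Finset.sum_congr rfl fun p _ => ?_
    have e : ∑ x, u (swap p.1 p.2 x) * v x = ∑ x, u x * v (swap p.1 p.2 x) := by
      rw [← Equiv.sum_comp (swap p.1 p.2)]
      simp
    have e1 : ∑ x, a p * (u x - u (swap p.1 p.2 x)) * v x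
        = a p * (∑ x, u x * v x - ∑ x, u (swap p.1 p.2 x) * v x) := by
      rw [← Finset.sum_sub_distrib, Finset.mul_sum]
      exact Finset.sum_congr rfl fun x _ => by ring
    rw [e1, e, ← Finset.sum_sub_distrib, Finset.mul_sum]
    exact Finset.sum_congr rfl fun x _ => by ring
  have hK : ∀ u ∈ K, A u ∈ K := by
    intro u _
    change ∑ x, A u x = 0
    simp only [hAx]
    rw [Finset.sum_comm]
    refine Finset.sum_eq_zero fun p _ => ?_
    rw [← Finset.mul_sum, Finset.sum_sub_distrib, Equiv.sum_comp (swap p.1 p.2) (fun x => u x),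
      sub_self, mul_zero]
  have main := form_ge_of_eig K A hsym hK ν (by
    intro l u hu hu0 hl
    refine h l (fun x => u x) ?_ hu ?_
    · intro h0; apply hu0; ext x; exact congrFun h0 x
    · funext x
      have : A u x = (l • u) x := by rw [hl]
      exact this)
  intro u hu
  have := main (WithLp.toLp 2 u) hu
  rw [hin, hin] at this
  simp only [hAx] at this
  rw [std_form] at this
  refine le_trans (le_of_eq ?_) this
  congr 1
  exact Finset.sum_congr rfl fun x _ => by ring
end

/-- right translation action on functions on `G`, restricted to `S_n` -/
noncomputable def regRep {G H : Type*} [Group G] [Group H] (e : H →* G) :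
    H →* Module.End ℝ (EuclideanSpace ℝ G) where
  toFun π :=
    { toFun := fun f => WithLp.toLp 2 fun g => f (g * e π)
      map_add' := by intro f f'; ext g; simp
      map_smul' := by intro t f; ext g; simp }
  map_one' := by ext f g; simp
  map_mul' π τ := by ext f g; simp [mul_assoc]

lemma shift_form {G : Type*} [Group G] [Fintype G] (f : G → ℝ) (h : G) :
    0 ≤ ∑ g, (f g - f (g * h)) * f g := by
  have e : ∑ g, f (g * h) ^ 2 = ∑ g, f g ^ 2 := Equiv.sum_comp (Equiv.mulRight h) (fun g => f g ^ 2)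
  have : 2 * ∑ g, (f g - f (g * h)) * f g
      = ∑ g, (f g - f (g * h)) ^ 2 + (∑ g, f g ^ 2 - ∑ g, f (g * h) ^ 2) := by
    rw [← Finset.sum_sub_distrib, ← Finset.sum_add_distrib, Finset.mul_sum]
    exact Finset.sum_congr rfl fun g _ => by ring
  rw [e, sub_self, add_zero] at this
  have h2 : 0 ≤ ∑ g, (f g - f (g * h)) ^ 2 := Finset.sum_nonneg fun g _ => sq_nonneg _
  linarith


end OwnMaterial

/-- Let w = w_T + w_N with w_T a nonnegative combination of transpositions and w_N a
nonnegative combination of the diagonal elements s_A. If σ is a nontrivial irreducible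
representation of Bₙ whose restriction to Sₙ contains no copy of the trivial
Sₙ-representation, then every eigenvalue μ of σ(Δ(w)) is at least the minimal nontrivial
eigenvalue ν of Δ(w) on the pullback of the standard Sₙ-irrep [n−1,1] (realized as the
sum-zero subspace of ℝⁿ, on which Δ(w) acts as Δ(w_T)). -/
theorem stmt14 (n : ℕ)
    (a : Fin n × Fin n → ℝ) (ha : ∀ p, 0 ≤ a p)
    (α : Finset (Fin n) → ℝ) (hα : ∀ A, 0 ≤ α A)
    (V : Type) [AddCommGroup V] [Module ℂ V] [FiniteDimensional ℂ V] [Nontrivial V]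
    (σ : Representation ℂ (Bn n) V)
    (hirr : ∀ W : Submodule ℂ V, (∀ g : Bn n, ∀ v ∈ W, σ g v ∈ W) → W = ⊥ ∨ W = ⊤)
    (hres : ¬ ∃ v : V, v ≠ 0 ∧ ∀ π : Equiv.Perm (Fin n), σ (SemidirectProduct.inr π) v = v)
    (T : V →ₗ[ℂ] V)
    (hT : T = ∑ p ∈ Finset.univ.filter (fun p : Fin n × Fin n => p.1 < p.2),
          (a p : ℂ) • ((LinearMap.id : V →ₗ[ℂ] V)
            - (σ (SemidirectProduct.inr (Equiv.swap p.1 p.2)) : V →ₗ[ℂ] V))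
        + ∑ A : Finset (Fin n),
          (α A : ℂ) • ((LinearMap.id : V →ₗ[ℂ] V)
            - (σ (SemidirectProduct.inl (sgn A)) : V →ₗ[ℂ] V)))
    (Tstd : (Fin n → ℝ) → (Fin n → ℝ))
    (hTstd : ∀ u, Tstd u = fun x =>
      ∑ p ∈ Finset.univ.filter (fun p : Fin n × Fin n => p.1 < p.2),
        a p * (u x - u (Equiv.swap p.1 p.2 x)))
    (μ : ℝ) (v : V) (hv : v ≠ 0) (hμ : T v = (μ : ℂ) • v)
    (ν : ℝ)
    (hν : ∃ u : Fin n → ℝ, u ≠ 0 ∧ (∑ i, u i = 0) ∧ Tstd u = ν • u)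
    (hνmin : ∀ (ν' : ℝ) (u : Fin n → ℝ), u ≠ 0 → (∑ i, u i = 0) → Tstd u = ν' • u → ν ≤ ν') :
    ν ≤ μ := by
  classical
  -- the function on `B_n`
  have : Finite (Bn n) := Finite.of_equiv _ SemidirectProduct.equivProd.symm
  let _ : Fintype (Bn n) := Fintype.ofFinite _
  obtain ⟨ψ0, hψ0⟩ : ∃ ψ : Module.Dual ℂ V, ψ v ≠ 0 := by
    by_contra hcon
    push Not at hcon
    exact hv ((Module.forall_dual_apply_eq_zero_iff ℂ v).1 hcon)
  set ψ : Module.Dual ℂ V := (ψ0 v)⁻¹ • ψ0 with hψ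
  have hψv : ψ v = 1 := by simp [hψ, hψ0]
  set f : Bn n → ℝ := fun g => (ψ (σ g v)).re with hf
  have hf1 : f 1 = 1 := by simp [hf, hψv]
  have heq : ∀ g, μ * f g = ∑ p ∈ Finset.univ.filter (fun p : Fin n × Fin n => p.1 < p.2),
        a p * (f g - f (g * SemidirectProduct.inr (Equiv.swap p.1 p.2)))
      + ∑ A : Finset (Fin n), α A * (f g - f (g * SemidirectProduct.inl (sgn A))) := by
    intro g
    have h := congrArg (fun z => (ψ (σ g z)).re) hμ
    simp only [hT, LinearMap.add_apply, LinearMap.sum_apply, LinearMap.smul_apply,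
      LinearMap.sub_apply, LinearMap.id_apply, map_add, map_sum, map_smul, map_sub,
      Complex.add_re, Complex.re_sum, smul_eq_mul, Complex.re_ofReal_mul, Complex.sub_re] at h
    rw [← h]
    simp only [hf, map_mul, Module.End.mul_apply]
  set φ := regRep (SemidirectProduct.inr : Equiv.Perm (Fin n) →* Bn n) with hφdef
  have hφa : ∀ π (w : EuclideanSpace ℝ (Bn n)) g, φ π w g = w (g * SemidirectProduct.inr π) :=
    fun π w g => rfl
  have hin : ∀ u w : EuclideanSpace ℝ (Bn n), inner ℝ u w = ∑ x, u x * w x := by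
    intro u w
    rw [PiLp.inner_apply]
    exact Finset.sum_congr rfl fun x _ => by simp [mul_comm]
  have hφ : ∀ π u w, inner ℝ (φ π u) (φ π w) = inner ℝ u w := by
    intro π u w
    rw [hin, hin]
    simp only [hφa]
    exact Equiv.sum_comp (Equiv.mulRight (SemidirectProduct.inr π : Bn n)) (fun g => u g * w g)
  set F : EuclideanSpace ℝ (Bn n) := WithLp.toLp 2 f with hF
  have hFa : ∀ g, F g = f g := fun g => rfl
  -- sum over `S_n` vanishes
  have hsum0 : ∑ π : Equiv.Perm (Fin n), σ (SemidirectProduct.inr π) v = 0 := by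
    by_contra hne
    refine hres ⟨_, hne, fun τ => ?_⟩
    rw [map_sum]
    simp only [← Module.End.mul_apply, ← map_mul]
    exact Equiv.sum_comp (Equiv.mulLeft τ)
      (fun π : Equiv.Perm (Fin n) => σ (SemidirectProduct.inr π) v)
  have hFsum : ∑ π : Equiv.Perm (Fin n), φ π F = 0 := by
    ext g
    have h := congrArg (fun z => (ψ (σ g z)).re) hsum0
    simp only [map_sum, Complex.re_sum, map_zero, Complex.zero_re] at h
    rw [WithLp.ofLp_sum, Finset.sum_apply]
    simp only [hφa, hFa, hf, map_mul, Module.End.mul_apply]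
    exact h
  have horth : ∀ w ∈ InvS φ Finset.univ, inner ℝ F w = 0 := by
    intro w hw
    have hinv : ∀ π : Equiv.Perm (Fin n), φ π w = w := by
      intro π
      induction π using Equiv.Perm.swap_induction_on with
      | one => simp
      | swap_mul g x y _ ih =>
        rw [map_mul, Module.End.mul_apply, ih]
        exact hw x (Finset.mem_univ _) y (Finset.mem_univ _)
    have h1 : ∑ π : Equiv.Perm (Fin n), inner ℝ (φ π F) w = 0 := by
      rw [← sum_inner, hFsum, inner_zero_left]
    have h2 : ∀ π : Equiv.Perm (Fin n), inner ℝ (φ π F) w = inner ℝ F w := by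
      intro π
      rw [← hφ π F w, hinv π]
    simp only [h2, Finset.sum_const, nsmul_eq_mul] at h1
    rcases mul_eq_zero.1 h1 with h | h
    · exfalso
      have : (Finset.univ : Finset (Equiv.Perm (Fin n))).card ≠ 0 := by
        rw [Finset.card_univ]; exact Fintype.card_ne_zero
      exact this (by exact_mod_cast h)
    · exact h
  have hgap : RWgap Finset.univ (wt a) ν := by
    apply rwgap_of_min
    intro ν' u hu hu0 he
    exact hνmin ν' u hu hu0 (by rw [hTstd]; exact he)
  have hν0 : 0 ≤ ν := by
    obtain ⟨u, hu, -, he⟩ := hν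
    rw [hTstd] at he
    have h1 := std_form a u
    have h2 : ∑ x, (∑ p ∈ Finset.univ.filter (fun p : Fin n × Fin n => p.1 < p.2),
        a p * (u x - u (Equiv.swap p.1 p.2 x))) * u x = ν * ∑ x, u x ^ 2 := by
      rw [Finset.mul_sum]
      refine Finset.sum_congr rfl fun x _ => ?_
      have := congrFun he x
      simp only [Pi.smul_apply, smul_eq_mul] at this
      rw [this]; ring
    rw [h2] at h1
    have h3 : 0 ≤ 1 / 2 * ∑ i, ∑ j, wt a i j * (u i - u j) ^ 2 :=
      mul_nonneg (by norm_num) (Finset.sum_nonneg fun i _ => Finset.sum_nonneg fun j _ =>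
        mul_nonneg (wt_nonneg a ha i j) (sq_nonneg _))
    obtain ⟨x, hx⟩ := Function.ne_iff.1 hu
    have hx' : u x ≠ 0 := hx
    have hpos : 0 < ∑ x, u x ^ 2 :=
      Finset.sum_pos' (fun y _ => sq_nonneg _) ⟨x, Finset.mem_univ _, by positivity⟩
    rw [← h1] at h3
    exact nonneg_of_mul_nonneg_left h3 hpos
  have main := aclr φ hφ Finset.univ (wt a) (wt_nonneg a ha) (wt_symm a) ν hν0 hgap F horth
  unfold En at main
  rw [← sum_pairs a (fun i j => inner ℝ F F - inner ℝ (φ (Equiv.swap i j) F) F)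
    (fun i j => by rw [Equiv.swap_comm])] at main
  have hFF : inner ℝ F F = ∑ g, f g * f g := hin F F
  have hpos : 0 < inner ℝ F F := by
    rw [hFF]
    exact Finset.sum_pos' (fun y _ => mul_self_nonneg _) ⟨1, Finset.mem_univ _, by rw [hf1]; norm_num⟩
  have hμF : μ * inner ℝ F F
      = ∑ p ∈ Finset.univ.filter (fun p : Fin n × Fin n => p.1 < p.2),
          a p * (inner ℝ F F - inner ℝ (φ (Equiv.swap p.1 p.2) F) F)
        + ∑ A : Finset (Fin n),
          α A * ∑ g, (f g - f (g * SemidirectProduct.inl (sgn A))) * f g := by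
    have e1 : ∀ t, inner ℝ F F - inner ℝ (φ t F) F
        = ∑ g, (f g - f (g * SemidirectProduct.inr t)) * f g := by
      intro t
      rw [hin, hin, ← Finset.sum_sub_distrib]
      exact Finset.sum_congr rfl fun g _ => by rw [hφa, hFa, hFa]; ring
    simp only [e1, Finset.mul_sum]
    rw [hFF, Finset.mul_sum, Finset.sum_comm]
    conv_rhs => rw [add_comm, Finset.sum_comm, add_comm, ← Finset.sum_add_distrib]
    refine Finset.sum_congr rfl fun g _ => ?_
    rw [← mul_assoc, heq g, add_mul, Finset.sum_mul, Finset.sum_mul]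
    simp only [mul_assoc]
  have hN : 0 ≤ ∑ A : Finset (Fin n),
      α A * ∑ g, (f g - f (g * SemidirectProduct.inl (sgn A))) * f g :=
    Finset.sum_nonneg fun A _ => mul_nonneg (hα A) (shift_form f _)
  have : ν * inner ℝ F F ≤ μ * inner ℝ F F := by rw [hμF]; linarith
  exact le_of_mul_le_mul_right this hpos
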